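/- arXiv:1207.1138 — 2 statements merged into one kernel-verified Lean document; each statement's English description precedes it below -/
import Mathlib

section
/- For any odd t such that p = 4t² + 9 is prime, the set of all fourth powers {x⁴ : x ∈ F_p} (including 0) is a cyclic difference set DS(p, (p+3)/4, (p+3)/16) in Z_p. -/
section CharacterSums

variable {F : Type*} [Field F] [Fintype F] [DecidableEq F]

/-- The correlation of the quadratic character with a translate of itself. -/
theorem sum_quadraticChar_sub_mul_sub (hF : ringChar F ≠ 2) (m n : F) :
    ∑ a : F, quadraticChar F (m - a) * quadraticChar F (n - a)
      = (if m = n then (Fintype.card F : ℤ) else 0) - 1 := by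
  split_ifs with hmn
  · subst hmn
    rw [← Equiv.sum_comp (Equiv.subLeft m)]
    simp only [Equiv.subLeft_apply, sub_sub_cancel]
    have h (a : F) : quadraticChar F a * quadraticChar F a = 1 - if a = 0 then 1 else 0 := by
      by_cases ha : a = 0
      · simp [ha]
      · rw [← sq, quadraticChar_sq_one ha, if_neg ha, sub_zero]
    simp [-quadraticChar_apply, h, Finset.sum_sub_distrib]
  · have hd : n - m ≠ 0 := sub_ne_zero.mpr (Ne.symm hmn)
    have hJ := jacobiSum_nontrivial_inv (quadraticChar_ne_one hF)
    rw [(quadraticChar_isQuadratic F).inv] at hJ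
    have hneg : quadraticChar F (-1) * quadraticChar F (-1) = 1 := by
      rw [← map_mul]; simp
    rw [← Equiv.sum_comp ((Equiv.mulLeft₀ _ hd).trans (Equiv.addLeft m))]
    have h (x : F) : quadraticChar F (m - ((Equiv.mulLeft₀ _ hd).trans (Equiv.addLeft m)) x) *
        quadraticChar F (n - ((Equiv.mulLeft₀ _ hd).trans (Equiv.addLeft m)) x)
        = quadraticChar F (-1) * (quadraticChar F x * quadraticChar F (1 - x)) := by
      have e1 : m - ((Equiv.mulLeft₀ _ hd).trans (Equiv.addLeft m)) x = -1 * (n - m) * x := by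
        simp only [Equiv.trans_apply, Equiv.mulLeft₀_apply, Equiv.coe_addLeft]; ring
      have e2 : n - ((Equiv.mulLeft₀ _ hd).trans (Equiv.addLeft m)) x = (n - m) * (1 - x) := by
        simp only [Equiv.trans_apply, Equiv.mulLeft₀_apply, Equiv.coe_addLeft]; ring
      rw [e1, e2]
      simp only [map_mul]
      linear_combination (quadraticChar F (-1) * quadraticChar F x * quadraticChar F (1 - x)) *
        quadraticChar_sq_one hd
    simp_rw [h]
    rw [← Finset.mul_sum]
    rw [jacobiSum] at hJ
    rw [hJ]
    linear_combination -hneg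

/-- A function invariant under multiplication by nonzero squares takes each of its two nonzero
class values equally often. -/
theorem two_mul_sum_of_mul_sq_invariant (hF : ringChar F ≠ 2) {g : F}
    (hg : quadraticChar F g = -1) (f : F → ℤ)
    (hf : ∀ d e : F, e ≠ 0 → f (d * e ^ 2) = f d) :
    2 * ∑ d : F, f d = 2 * f 0 + (Fintype.card F - 1) * (f 1 + f g) := by
  have hg0 : g ≠ 0 := by rintro rfl; simp at hg
  have h (d : F) : 2 * f d = (1 + quadraticChar F d) * f 1 + (1 - quadraticChar F d) * f g
      + (if d = 0 then 1 else 0) * (2 * f 0 - f 1 - f g) := by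
    by_cases hd : d = 0
    · simp [hd]
    rcases quadraticChar_dichotomy hd with h1 | h1
    · obtain ⟨e, rfl⟩ := (quadraticChar_one_iff_isSquare hd).mp h1
      have := hf 1 e (by rintro rfl; simp at hd)
      rw [one_mul, sq] at this
      rw [h1, this]; simp [hd]
    · have h2 : quadraticChar F (d * g⁻¹) = 1 := by
        have : quadraticChar F (d * g⁻¹) * quadraticChar F g = -1 := by
          rw [← map_mul, inv_mul_cancel_right₀ hg0, h1]
        rw [hg] at this; linarith
      obtain ⟨e, he⟩ := (quadraticChar_one_iff_isSquare
        (mul_ne_zero hd (inv_ne_zero hg0))).mp h2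
      have hde : d = g * e ^ 2 := by field_simp at he; rw [he]
      have := hf g e (by rintro rfl; simp at hde; exact hd hde)
      rw [h1, hde, this]
      have : g * e ^ 2 ≠ 0 := hde ▸ hd
      rw [if_neg this]; ring
  rw [Finset.mul_sum, Finset.sum_congr rfl (fun d _ => h d)]
  simp only [Finset.sum_add_distrib, ← Finset.sum_mul, Finset.sum_sub_distrib,
    quadraticChar_sum_zero hF, Finset.sum_ite_eq', Finset.mem_univ, if_true]
  simp
  ring

variable (F) in
/-- Jacobsthal's sum attached to the cubic `v * (v ^ 2 - a)`. -/
def jacobsthalSum (a : F) : ℤ := ∑ v : F, quadraticChar F v * quadraticChar F (v ^ 2 - a)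

theorem jacobsthalSum_mul_sq (a : F) {c : F} (hc : c ≠ 0) :
    jacobsthalSum F (a * c ^ 2) = quadraticChar F c * jacobsthalSum F a := by
  unfold jacobsthalSum
  rw [← Equiv.sum_comp (Equiv.mulLeft₀ _ hc), Finset.mul_sum]
  refine Finset.sum_congr rfl fun v _ => ?_
  have e : (c * v) ^ 2 - a * c ^ 2 = c ^ 2 * (v ^ 2 - a) := by ring
  simp only [Equiv.mulLeft₀_apply]
  rw [e, map_mul, map_mul, map_pow, quadraticChar_sq_one hc]
  ring

theorem sum_ite_sq_eq_sq_mul_quadraticChar (hF : ringChar F ≠ 2)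
    (hneg : quadraticChar F (-1) = 1) (v : F) :
    ∑ w : F, (if v ^ 2 = w ^ 2 then quadraticChar F w else 0) = 2 * quadraticChar F v := by
  by_cases hv : v = 0
  · subst hv
    refine (Finset.sum_eq_zero fun w _ => ?_).trans (by simp)
    split_ifs with h
    · have : w = 0 := by simpa using h.symm
      simp [this]
    · rfl
  · have hne : v ≠ -v := fun h => hv ((Ring.eq_self_iff_eq_zero_of_char_ne_two hF).mp h.symm)
    have hset : Finset.univ.filter (fun w : F => v ^ 2 = w ^ 2) = {v, -v} := by
      ext w
      simp only [Finset.mem_filter, Finset.mem_univ, true_and, Finset.mem_insert,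
        Finset.mem_singleton, sq_eq_sq_iff_eq_or_eq_neg]
      constructor
      · rintro (h | h) <;> simp [h]
      · rintro (h | h) <;> simp [h]
    rw [← Finset.sum_filter, hset, Finset.sum_pair hne, ← neg_one_mul v, map_mul, hneg]
    ring

/-- Jacobsthal's identity. -/
theorem jacobsthalSum_one_sq_add_sq (hF : ringChar F ≠ 2) (hneg : quadraticChar F (-1) = 1)
    {g : F} (hg : quadraticChar F g = -1) :
    jacobsthalSum F 1 ^ 2 + jacobsthalSum F g ^ 2 = 4 * (Fintype.card F : ℤ) := by
  have hinv := two_mul_sum_of_mul_sq_invariant hF hg (fun a => jacobsthalSum F a ^ 2)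
    (fun d e he => by
      simp only [jacobsthalSum_mul_sq d he, mul_pow, quadraticChar_sq_one he, one_mul])
  have h0 : jacobsthalSum F 0 = 0 := by
    rw [← quadraticChar_sum_zero hF, jacobsthalSum]
    refine Finset.sum_congr rfl fun v _ => ?_
    by_cases hv : v = 0
    · simp [hv]
    · rw [sub_zero, map_pow, quadraticChar_sq_one hv, mul_one]
  have hsum : ∑ a : F, jacobsthalSum F a ^ 2
      = 2 * Fintype.card F * (Fintype.card F - 1) := by
    calc ∑ a : F, jacobsthalSum F a ^ 2
        = ∑ a : F, ∑ v : F, ∑ w : F, quadraticChar F v * quadraticChar F w *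
            (quadraticChar F (v ^ 2 - a) * quadraticChar F (w ^ 2 - a)) := by
          refine Finset.sum_congr rfl fun a _ => ?_
          rw [sq, jacobsthalSum, Finset.sum_mul_sum]
          refine Finset.sum_congr rfl fun v _ => Finset.sum_congr rfl fun w _ => by ring
      _ = ∑ v : F, ∑ w : F, quadraticChar F v * quadraticChar F w *
            ∑ a : F, quadraticChar F (v ^ 2 - a) * quadraticChar F (w ^ 2 - a) := by
          rw [Finset.sum_comm]
          refine Finset.sum_congr rfl fun v _ => ?_
          rw [Finset.sum_comm]
          simp_rw [Finset.mul_sum]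
      _ = ∑ v : F, (Fintype.card F * quadraticChar F v *
            (∑ w : F, if v ^ 2 = w ^ 2 then quadraticChar F w else 0)
              - quadraticChar F v * ∑ w : F, quadraticChar F w) := by
          refine Finset.sum_congr rfl fun v _ => ?_
          rw [Finset.mul_sum, Finset.mul_sum, ← Finset.sum_sub_distrib]
          refine Finset.sum_congr rfl fun w _ => ?_
          rw [sum_quadraticChar_sub_mul_sub hF]
          split_ifs <;> ring
      _ = 2 * Fintype.card F * ∑ v : F, quadraticChar F (0 - v) * quadraticChar F (0 - v) := by
          rw [quadraticChar_sum_zero hF, Finset.mul_sum]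
          refine Finset.sum_congr rfl fun v _ => ?_
          rw [sum_ite_sq_eq_sq_mul_quadraticChar hF hneg, zero_sub, ← neg_one_mul v, map_mul, hneg]
          ring
      _ = _ := by rw [sum_quadraticChar_sub_mul_sub hF, if_pos rfl]
  simp only [h0] at hinv
  rw [hsum] at hinv
  have hc : (Fintype.card F : ℤ) - 1 ≠ 0 := by
    have := Fintype.one_lt_card (α := F)
    omega
  exact mul_left_cancel₀ hc (by linarith)

end CharacterSums

theorem sq_eq_nine_of_sq_add_sq_eq {p : ℕ} (hp : p.Prime) {t a b : ℤ}
    (hpt : (p : ℤ) = 4 * t ^ 2 + 9) (ha : Odd a) (hab : a ^ 2 + b ^ 2 = p) : a ^ 2 = 9 := by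
  have hp' : Prime (p : ℤ) := Nat.prime_iff_prime_int.mp hp
  have hpos : (0 : ℤ) < p := by exact_mod_cast hp.pos
  have key : ∀ c : ℤ, a ^ 2 + c ^ 2 = p → (p : ℤ) ∣ 2 * t * a - 3 * c → a ^ 2 = 9 := by
    rintro c hc ⟨k, hk⟩
    have h1 : (3 * a + 2 * t * c) ^ 2 + (p * k) ^ 2 = p ^ 2 := by
      rw [← hk]
      linear_combination (4 * t ^ 2 + 9) * hc - (p : ℤ) * hpt
    have hk1 : k ^ 2 ≤ 1 := by
      have : (p : ℤ) ^ 2 * k ^ 2 ≤ p ^ 2 * 1 := by nlinarith [sq_nonneg (3 * a + 2 * t * c)]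
      exact le_of_mul_le_mul_left this (by positivity)
    have hk2 : k ^ 2 = 0 ∨ k ^ 2 = 1 := by
      have := sq_nonneg k
      omega
    rcases hk2 with hk2 | hk2
    · have hk0 : k = 0 := by simpa using hk2
      rw [hk0, mul_zero] at hk
      have : (p : ℤ) * (a ^ 2 - 9) = 0 := by
        linear_combination (2 * t * a + 3 * c) * hk + a ^ 2 * hpt + 9 * hc
      rcases mul_eq_zero.mp this with h | h <;> omega
    · have h2 : (3 * a + 2 * t * c) ^ 2 = 0 := by
        linear_combination h1 - (p : ℤ) ^ 2 * hk2
      have h3 : 3 * a + 2 * (t * c) = 0 := by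
        have := pow_eq_zero_iff (two_ne_zero) |>.mp h2
        linarith
      obtain ⟨m, rfl⟩ := ha
      omega
  have hdvd : (p : ℤ) ∣ (2 * t * a - 3 * b) * (2 * t * a - 3 * -b) :=
    ⟨a ^ 2 - 9, by linear_combination -a ^ 2 * hpt - 9 * hab⟩
  rcases hp'.dvd_or_dvd hdvd with h | h
  · exact key b hab h
  · exact key (-b) (by linarith [neg_sq b]) h

theorem ringChar_ne_two_of_card_mod_eight {F : Type*} [Field F] [Fintype F]
    (hq : Fintype.card F % 8 = 5) : ringChar F ≠ 2 := by
  intro h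
  have := FiniteField.even_card_iff_char_two.mp h
  omega

section FourthPowers

variable {F : Type*} [Field F] [Fintype F] [DecidableEq F]

theorem quadraticChar_neg_one_of_card_mod_eight (hq : Fintype.card F % 8 = 5) :
    quadraticChar F (-1) = 1 := by
  rw [quadraticChar_neg_one (ringChar_ne_two_of_card_mod_eight hq), ZMod.χ₄_nat_one_mod_four]
  omega

theorem quadraticChar_two_of_card_mod_eight (hq : Fintype.card F % 8 = 5) :
    quadraticChar F 2 = -1 := by
  rw [quadraticChar_two (ringChar_ne_two_of_card_mod_eight hq), ZMod.χ₈_nat_mod_eight, hq]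
  rfl

/-- When the order of the field is `5` modulo `8`, square roots of `-1` exist and are nonsquares. -/
theorem exists_sq_eq_neg_one_and_quadraticChar_eq_neg_one (hq : Fintype.card F % 8 = 5) :
    ∃ i : F, i ^ 2 = -1 ∧ quadraticChar F i = -1 := by
  obtain ⟨i, hi⟩ := (quadraticChar_one_iff_isSquare (neg_ne_zero.mpr one_ne_zero)).mp
    (quadraticChar_neg_one_of_card_mod_eight hq)
  have hi2 : i ^ 2 = -1 := by rw [sq, hi]
  have h2 := quadraticChar_two_of_card_mod_eight hq
  have h20 : (2 : F) ≠ 0 := Ring.two_ne_zero (ringChar_ne_two_of_card_mod_eight hq)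
  have hi0 : i ≠ 0 := by rintro rfl; simp at hi2
  have e : (1 + i) ^ 2 = 2 * i := by linear_combination hi2
  have h1i : 1 + i ≠ 0 := by
    intro h
    rw [h] at e
    exact mul_ne_zero h20 hi0 (by rw [← e]; simp)
  have h := quadraticChar_sq_one' h1i
  rw [e, map_mul, h2] at h
  exact ⟨i, hi2, by linarith⟩

theorem pow_four_ne_neg_one (hq : Fintype.card F % 8 = 5) (x : F) : x ^ 4 ≠ -1 := by
  intro h
  obtain ⟨i, hi, hχ⟩ := exists_sq_eq_neg_one_and_quadraticChar_eq_neg_one hq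
  have hx : x ≠ 0 := by rintro rfl; simp at h
  have h1 := quadraticChar_sq_one' hx
  have h2 : (x ^ 2) ^ 2 = i ^ 2 := by rw [hi, ← h]; ring
  rcases sq_eq_sq_iff_eq_or_eq_neg.mp h2 with h3 | h3
  · rw [h3, hχ] at h1; norm_num at h1
  · rw [h3, ← neg_one_mul, map_mul, hχ, quadraticChar_neg_one_of_card_mod_eight hq] at h1
    norm_num at h1

theorem exists_pow_four_eq_or_eq_neg (hq : Fintype.card F % 8 = 5) (e : F) :
    ∃ s : F, e ^ 2 = s ^ 4 ∨ e ^ 2 = -s ^ 4 := by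
  obtain ⟨i, hi, hχ⟩ := exists_sq_eq_neg_one_and_quadraticChar_eq_neg_one hq
  by_cases he : e = 0
  · exact ⟨0, by simp [he]⟩
  have hi0 : i ≠ 0 := by rintro rfl; simp at hi
  rcases quadraticChar_dichotomy he with h | h
  · obtain ⟨s, hs⟩ := (quadraticChar_one_iff_isSquare he).mp h
    exact ⟨s, Or.inl (by rw [hs]; ring)⟩
  · have h1 : quadraticChar F (i * e) = 1 := by rw [map_mul, h, hχ]; rfl
    obtain ⟨s, hs⟩ := (quadraticChar_one_iff_isSquare (mul_ne_zero hi0 he)).mp h1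
    exact ⟨s, Or.inr (by linear_combination (-(i * e) - s ^ 2) * hs + e ^ 2 * hi)⟩

theorem card_filter_pow_four_eq (hq : Fintype.card F % 8 = 5) {x : F} (hx : x ≠ 0) :
    (Finset.univ.filter fun y : F => y ^ 4 = x ^ 4).card = 4 := by
  obtain ⟨i, hi, hχ⟩ := exists_sq_eq_neg_one_and_quadraticChar_eq_neg_one hq
  have hF := ringChar_ne_two_of_card_mod_eight hq
  have h2 : (2 : F) ≠ 0 := Ring.two_ne_zero hF
  have hi1 : i ≠ 1 := by rintro rfl; simp [-quadraticChar_apply] at hχ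
  have hi2 : i ≠ -1 := by
    rintro rfl
    rw [quadraticChar_neg_one_of_card_mod_eight hq] at hχ
    norm_num at hχ
  have h1 : (1 : F) ≠ -1 := fun h => h2 (by linear_combination h)
  have hi0 : i ≠ -i := by
    intro h
    have : i = 0 := (Ring.eq_self_iff_eq_zero_of_char_ne_two hF).mp h.symm
    rw [this] at hi; simp at hi
  have hset : (Finset.univ.filter fun y : F => y ^ 4 = x ^ 4)
      = ({1, -1, i, -i} : Finset F).image (· * x) := by
    ext y
    simp only [Finset.mem_filter, Finset.mem_univ, true_and, Finset.mem_image, Finset.mem_insert,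
      Finset.mem_singleton, exists_eq_or_imp, exists_eq_left]
    constructor
    · intro h
      have : (1 * x - y) * ((-1 * x - y) * ((i * x - y) * (-i * x - y))) = 0 := by
        linear_combination h + (x ^ 4 - x ^ 2 * y ^ 2) * hi
      simpa only [mul_eq_zero, sub_eq_zero] using this
    · rintro (rfl | rfl | rfl | rfl)
      · ring
      · ring
      · linear_combination x ^ 4 * (i ^ 2 - 1) * hi
      · linear_combination x ^ 4 * (i ^ 2 - 1) * hi
  rw [hset, Finset.card_image_of_injective _ (mul_left_injective₀ hx)]
  have hi1' : -i ≠ 1 := fun h => hi2 (by linear_combination -h)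
  have hi2' : -i ≠ -1 := fun h => hi1 (by linear_combination -h)
  simp [Finset.card_insert_of_notMem, h1, hi1.symm, hi2.symm, hi0, hi1'.symm, hi2'.symm]

variable (F) in
/-- The set of fourth powers, including `0`. -/
def fourthPowers : Finset F := Finset.univ.image fun x : F => x ^ 4

/-- The number of representations of `d` as a difference of two fourth powers. -/
def fourthPowerDiffCount (d : F) : ℕ :=
  ((fourthPowers F ×ˢ fourthPowers F).filter fun q => q.1 - q.2 = d).card

theorem mem_fourthPowers {a : F} : a ∈ fourthPowers F ↔ ∃ x : F, x ^ 4 = a := by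
  simp [fourthPowers]

theorem card_filter_pow_four_eq_ite (hq : Fintype.card F % 8 = 5) {a : F}
    (ha : a ∈ fourthPowers F) :
    (Finset.univ.filter fun y : F => y ^ 4 = a).card = if a = 0 then 1 else 4 := by
  obtain ⟨x, rfl⟩ := mem_fourthPowers.mp ha
  by_cases hx : x = 0
  · subst hx
    have : (Finset.univ.filter fun y : F => y ^ 4 = 0 ^ 4) = {0} := by ext; simp
    rw [this]; simp
  · rw [card_filter_pow_four_eq hq hx]; simp [hx]

theorem four_mul_card_fourthPowers (hq : Fintype.card F % 8 = 5) :
    4 * (fourthPowers F).card = Fintype.card F + 3 := by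
  have h := Finset.card_eq_sum_card_fiberwise (s := (Finset.univ : Finset F))
    (t := fourthPowers F) (f := fun x => x ^ 4) (fun x _ => mem_fourthPowers.mpr ⟨x, rfl⟩)
  rw [Finset.sum_congr rfl fun a ha => card_filter_pow_four_eq_ite hq ha] at h
  have h0 : (0 : F) ∈ fourthPowers F := mem_fourthPowers.mpr ⟨0, by simp⟩
  have h' : ∑ a ∈ fourthPowers F, ((if a = 0 then 1 else 4) + if a = 0 then 3 else 0)
      = 4 * (fourthPowers F).card := by
    rw [Finset.sum_congr rfl (g := fun _ => 4) fun a _ => by split_ifs <;> rfl]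
    simp [mul_comm]
  rw [Finset.sum_add_distrib, ← h] at h'
  simp [h0] at h'
  omega

theorem fourthPowerDiffCount_mul_pow_four (d : F) {c : F} (hc : c ≠ 0) :
    fourthPowerDiffCount (d * c ^ 4) = fourthPowerDiffCount d := by
  have hc4 : c ^ 4 ≠ 0 := pow_ne_zero 4 hc
  refine (Finset.card_bij (fun q _ => (q.1 * c ^ 4, q.2 * c ^ 4)) ?_ ?_ ?_).symm
  · rintro ⟨a, b⟩ h
    simp only [Finset.mem_filter, Finset.mem_product, mem_fourthPowers] at h ⊢
    obtain ⟨⟨⟨x, rfl⟩, ⟨y, rfl⟩⟩, rfl⟩ := h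
    exact ⟨⟨⟨x * c, by ring⟩, ⟨y * c, by ring⟩⟩, by ring⟩
  · rintro ⟨a, b⟩ _ ⟨a', b'⟩ _ h
    simpa [hc] using h
  · rintro ⟨a, b⟩ h
    simp only [Finset.mem_filter, Finset.mem_product, mem_fourthPowers] at h
    obtain ⟨⟨⟨x, rfl⟩, ⟨y, rfl⟩⟩, h⟩ := h
    refine ⟨((x / c) ^ 4, (y / c) ^ 4), ?_, ?_⟩
    · simp only [Finset.mem_filter, Finset.mem_product, mem_fourthPowers]
      refine ⟨⟨⟨_, rfl⟩, ⟨_, rfl⟩⟩, ?_⟩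
      field_simp
      rw [h, mul_comm]
    · simp only [Prod.mk.injEq]
      constructor <;> field_simp

theorem fourthPowerDiffCount_neg (d : F) :
    fourthPowerDiffCount (-d) = fourthPowerDiffCount d := by
  refine Finset.card_bij (fun q _ => q.swap) ?_ ?_ ?_
  · rintro ⟨a, b⟩ h
    simp only [Finset.mem_filter, Finset.mem_product, Prod.swap] at h ⊢
    exact ⟨h.1.symm, by linear_combination -h.2⟩
  · intro a _ b _ h
    exact Prod.swap_injective h
  · rintro ⟨a, b⟩ h
    simp only [Finset.mem_filter, Finset.mem_product] at h
    refine ⟨(b, a), ?_, rfl⟩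
    simp only [Finset.mem_filter, Finset.mem_product]
    exact ⟨h.1.symm, by linear_combination -h.2⟩

theorem fourthPowerDiffCount_mul_sq (hq : Fintype.card F % 8 = 5) (d : F) {e : F} (he : e ≠ 0) :
    fourthPowerDiffCount (d * e ^ 2) = fourthPowerDiffCount d := by
  obtain ⟨s, hs⟩ := exists_pow_four_eq_or_eq_neg hq e
  have hs0 : s ≠ 0 := by rintro rfl; simp [he] at hs
  rcases hs with hs | hs
  · rw [hs, fourthPowerDiffCount_mul_pow_four d hs0]
  · rw [hs, mul_neg, fourthPowerDiffCount_neg, fourthPowerDiffCount_mul_pow_four d hs0]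

theorem sum_fourthPowerDiffCount :
    ∑ d : F, fourthPowerDiffCount d = (fourthPowers F).card ^ 2 := by
  rw [sq, ← Finset.card_product]
  exact (Finset.card_eq_sum_card_fiberwise (f := fun q : F × F => q.1 - q.2)
    fun _ _ => Finset.mem_univ _).symm

theorem fourthPowerDiffCount_zero :
    fourthPowerDiffCount (0 : F) = (fourthPowers F).card := by
  refine (Finset.card_bij (fun a _ => (a, a)) ?_ ?_ ?_).symm
  · intro a ha
    simp [ha]
  · intro a _ b _ h
    exact (Prod.mk.inj h).1
  · rintro ⟨a, b⟩ h
    simp only [Finset.mem_filter, Finset.mem_product, sub_eq_zero] at h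
    exact ⟨a, h.1.1, by rw [← h.2]⟩

/-- The counts at a square and at a nonsquare are complementary. -/
theorem fourthPowerDiffCount_one_add (hq : Fintype.card F % 8 = 5) {g : F}
    (hg : quadraticChar F g = -1) :
    8 * (fourthPowerDiffCount (1 : F) + fourthPowerDiffCount g : ℤ) = Fintype.card F + 3 := by
  have h := two_mul_sum_of_mul_sq_invariant (ringChar_ne_two_of_card_mod_eight hq) hg
    (fun d => (fourthPowerDiffCount d : ℤ)) fun d e he => by
      rw [fourthPowerDiffCount_mul_sq hq d he]
  rw [← Nat.cast_sum, sum_fourthPowerDiffCount, fourthPowerDiffCount_zero] at h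
  have hk : 4 * ((fourthPowers F).card : ℤ) = Fintype.card F + 3 := by
    exact_mod_cast four_mul_card_fourthPowers hq
  have hc : (Fintype.card F : ℤ) - 1 ≠ 0 := by
    have := Fintype.one_lt_card (α := F)
    omega
  refine mul_left_cancel₀ hc ?_
  push_cast at h
  linear_combination -8 * h + (4 * ((fourthPowers F).card : ℤ) + Fintype.card F - 1) * hk

variable (F) in
/-- The affine Fermat-type curve `x ^ 4 - y ^ 4 = 1`. -/
def quarticPoints : Finset (F × F) := Finset.univ.filter fun z => z.1 ^ 4 - z.2 ^ 4 = 1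

theorem card_quarticPoints_eq (hq : Fintype.card F % 8 = 5) :
    (quarticPoints F).card + 12 = 16 * fourthPowerDiffCount (1 : F) := by
  set P := (fourthPowers F ×ˢ fourthPowers F).filter fun q => q.1 - q.2 = 1 with hP
  have h := Finset.card_eq_sum_card_fiberwise (s := quarticPoints F)
    (t := P) (f := fun z => (z.1 ^ 4, z.2 ^ 4)) (by
      intro z hz
      simp only [quarticPoints, Finset.coe_filter, Finset.mem_univ, true_and,
        Set.mem_ofPred_eq] at hz
      simp only [hP, Finset.coe_filter, Set.mem_ofPred_eq, Finset.mem_product, mem_fourthPowers]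
      exact ⟨⟨⟨_, rfl⟩, ⟨_, rfl⟩⟩, hz⟩)
  have hfib : ∀ q ∈ P, ((quarticPoints F).filter fun z => (z.1 ^ 4, z.2 ^ 4) = q).card
      + (if q = (1, 0) then 12 else 0) = 16 := by
    rintro ⟨a, b⟩ hab
    simp only [hP, Finset.mem_filter, Finset.mem_product] at hab
    obtain ⟨⟨ha, hb⟩, hd⟩ := hab
    have hset : ((quarticPoints F).filter fun z => (z.1 ^ 4, z.2 ^ 4) = (a, b))
        = (Finset.univ.filter fun y : F => y ^ 4 = a) ×ˢ
          (Finset.univ.filter fun y : F => y ^ 4 = b) := by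
      ext ⟨x, y⟩
      simp only [quarticPoints, Finset.mem_filter, Finset.mem_univ, true_and, Prod.mk.injEq,
        Finset.mem_product, and_iff_right_iff_imp]
      rintro ⟨rfl, rfl⟩
      exact hd
    rw [hset, Finset.card_product, card_filter_pow_four_eq_ite hq ha,
      card_filter_pow_four_eq_ite hq hb]
    have ha0 : a ≠ 0 := by
      rintro rfl
      obtain ⟨y, rfl⟩ := mem_fourthPowers.mp hb
      exact pow_four_ne_neg_one hq y (by linear_combination -hd)
    by_cases hb0 : b = 0
    · subst hb0
      rw [sub_zero] at hd
      simp [hd]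
    · simp [ha0, hb0]
  have hsum := Finset.sum_congr rfl hfib
  rw [Finset.sum_add_distrib, ← h] at hsum
  have h10 : ((1, 0) : F × F) ∈ P := by
    simp only [hP, Finset.mem_filter, Finset.mem_product, mem_fourthPowers]
    exact ⟨⟨⟨1, by simp⟩, ⟨0, by simp⟩⟩, by simp⟩
  simp only [Finset.sum_ite_eq', h10, if_true, Finset.sum_const, smul_eq_mul] at hsum
  rw [hsum, mul_comm]
  rfl

theorem card_filter_sq_eq (hF : ringChar F ≠ 2) (a : F) :
    ((Finset.univ.filter fun x : F => x ^ 2 = a).card : ℤ) = quadraticChar F a + 1 := by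
  rw [← quadraticChar_card_sqrts hF a]
  congr 2
  ext; simp

/-- The number of points of `x ^ 4 - y ^ 4 = 1`, through the parametrisation
`x ^ 2 = (u + u⁻¹) / 2`, `y ^ 2 = (u⁻¹ - u) / 2`. -/
theorem card_quarticPoints_eq_sum (hF : ringChar F ≠ 2) :
    ((quarticPoints F).card : ℤ) + 1 = ∑ u : F,
      (quadraticChar F ((u + u⁻¹) / 2) + 1) * (quadraticChar F ((u⁻¹ - u) / 2) + 1) := by
  have h2 : (2 : F) ≠ 0 := Ring.two_ne_zero hF
  have h := Finset.card_eq_sum_card_fiberwise (s := quarticPoints F)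
    (t := Finset.univ) (f := fun z => z.1 ^ 2 - z.2 ^ 2) (fun _ _ => Finset.mem_univ _)
  have hfib (u : F) : (((quarticPoints F).filter fun z => z.1 ^ 2 - z.2 ^ 2 = u).card : ℤ)
      + (if u = 0 then 1 else 0)
      = (quadraticChar F ((u + u⁻¹) / 2) + 1) * (quadraticChar F ((u⁻¹ - u) / 2) + 1) := by
    by_cases hu : u = 0
    · subst hu
      have : ((quarticPoints F).filter fun z => z.1 ^ 2 - z.2 ^ 2 = 0) = ∅ := by
        refine Finset.filter_eq_empty_iff.mpr fun z hz h0 => ?_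
        simp only [quarticPoints, Finset.mem_filter, Finset.mem_univ, true_and] at hz
        exact one_ne_zero (hz.symm.trans (by linear_combination (z.1 ^ 2 + z.2 ^ 2) * h0))
      rw [this]; simp
    · have hset : ((quarticPoints F).filter fun z => z.1 ^ 2 - z.2 ^ 2 = u)
          = (Finset.univ.filter fun x : F => x ^ 2 = (u + u⁻¹) / 2) ×ˢ
            (Finset.univ.filter fun y : F => y ^ 2 = (u⁻¹ - u) / 2) := by
        ext ⟨x, y⟩
        simp only [quarticPoints, Finset.mem_filter, Finset.mem_univ, true_and,
          Finset.mem_product]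
        constructor
        · rintro ⟨h1, rfl⟩
          have : (x ^ 2 - y ^ 2)⁻¹ = x ^ 2 + y ^ 2 :=
            inv_eq_of_mul_eq_one_right (by linear_combination h1)
          rw [this]
          constructor <;> field_simp <;> ring
        · rintro ⟨hx, hy⟩
          have hd : x ^ 2 - y ^ 2 = u := by rw [hx, hy]; field_simp; ring
          have hs : x ^ 2 + y ^ 2 = u⁻¹ := by rw [hx, hy]; field_simp; ring
          refine ⟨?_, hd⟩
          rw [show x ^ 4 - y ^ 4 = (x ^ 2 - y ^ 2) * (x ^ 2 + y ^ 2) by ring, hd, hs,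
            mul_inv_cancel₀ hu]
      rw [hset, Finset.card_product, Nat.cast_mul, card_filter_sq_eq hF, card_filter_sq_eq hF,
        if_neg hu, add_zero]
  rw [← Finset.sum_congr rfl fun u _ => hfib u, Finset.sum_add_distrib, h]
  simp

theorem sum_comp_sq (hF : ringChar F ≠ 2) (f : F → ℤ) :
    ∑ u : F, f (u ^ 2) = ∑ v : F, (quadraticChar F v + 1) * f v := by
  rw [← Finset.sum_fiberwise Finset.univ (fun u : F => u ^ 2)]
  refine Finset.sum_congr rfl fun v _ => ?_
  rw [← card_filter_sq_eq hF, Finset.sum_congr rfl (g := fun _ => f v) fun u hu => by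
    rw [(Finset.mem_filter.mp hu).2]]
  simp

theorem card_quarticPoints_eq_jacobsthalSum (hq : Fintype.card F % 8 = 5) :
    ((quarticPoints F).card : ℤ) = Fintype.card F - 3 + jacobsthalSum F 1 := by
  have hF := ringChar_ne_two_of_card_mod_eight hq
  have h2 : (2 : F) ≠ 0 := Ring.two_ne_zero hF
  have hneg := quadraticChar_neg_one_of_card_mod_eight hq
  have hχ2 := quadraticChar_two_of_card_mod_eight hq
  obtain ⟨i, hi, hχi⟩ := exists_sq_eq_neg_one_and_quadraticChar_eq_neg_one hq
  have hi0 : i ≠ 0 := by rintro rfl; simp at hi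
  have hplus (u : F) : quadraticChar F ((u + u⁻¹) / 2)
      = -(quadraticChar F u * quadraticChar F (u ^ 2 - -1)) := by
    by_cases hu : u = 0
    · simp [hu]
    rw [← mul_one (quadraticChar F ((u + u⁻¹) / 2)),
      ← quadraticChar_sq_one' (mul_ne_zero h2 hu), ← map_mul,
      show (u + u⁻¹) / 2 * (2 * u) ^ 2 = 2 * (u * (u ^ 2 - -1)) by field_simp; ring,
      map_mul, map_mul, hχ2]
    ring
  have hminus (u : F) : quadraticChar F ((u⁻¹ - u) / 2)
      = -(quadraticChar F u * quadraticChar F (u ^ 2 - 1)) := by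
    by_cases hu : u = 0
    · simp [hu]
    rw [← mul_one (quadraticChar F ((u⁻¹ - u) / 2)),
      ← quadraticChar_sq_one' (mul_ne_zero h2 hu), ← map_mul,
      show (u⁻¹ - u) / 2 * (2 * u) ^ 2 = -1 * (2 * (u * (u ^ 2 - 1))) by field_simp; ring,
      map_mul, map_mul, map_mul, hχ2, hneg]
    ring
  have hJ : jacobsthalSum F (-1) = -jacobsthalSum F 1 := by
    rw [← hi, ← one_mul (i ^ 2), jacobsthalSum_mul_sq 1 hi0, hχi]; ring
  have hprod (u : F) : quadraticChar F ((u + u⁻¹) / 2) * quadraticChar F ((u⁻¹ - u) / 2)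
      = quadraticChar F (1 - (u ^ 2)) * quadraticChar F (-1 - (u ^ 2))
        - if u = 0 then 1 else 0 := by
    by_cases hu : u = 0
    · simp [-quadraticChar_apply, quadraticChar_zero, hu, hneg]
    rw [hplus, hminus, if_neg hu,
      show 1 - u ^ 2 = -1 * (u ^ 2 - 1) by ring, show -1 - u ^ 2 = -1 * (u ^ 2 - -1) by ring,
      map_mul, map_mul, hneg]
    linear_combination quadraticChar F (u ^ 2 - -1) * quadraticChar F (u ^ 2 - 1)
      * quadraticChar_sq_one hu
  have h11 : (1 : F) ≠ -1 := fun h => h2 (by linear_combination h)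
  have hquart : ∑ u : F, quadraticChar F (1 - (u ^ 2)) * quadraticChar F (-1 - (u ^ 2))
      = jacobsthalSum F 1 - 1 := by
    rw [sum_comp_sq hF fun v => quadraticChar F (1 - v) * quadraticChar F (-1 - v)]
    simp only [add_mul, one_mul, Finset.sum_add_distrib, sum_quadraticChar_sub_mul_sub hF,
      if_neg h11, zero_sub]
    rw [jacobsthalSum, ← sub_eq_add_neg]
    congr 1
    refine Finset.sum_congr rfl fun v _ => ?_
    rw [← map_mul, show (1 - v) * (-1 - v) = v ^ 2 - 1 by ring]
  have h := card_quarticPoints_eq_sum hF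
  have hterm (u : F) :
      (quadraticChar F ((u + u⁻¹) / 2) + 1) * (quadraticChar F ((u⁻¹ - u) / 2) + 1)
      = quadraticChar F (1 - (u ^ 2)) * quadraticChar F (-1 - (u ^ 2))
        - (if u = 0 then 1 else 0) - quadraticChar F u * quadraticChar F (u ^ 2 - -1)
        - quadraticChar F u * quadraticChar F (u ^ 2 - 1) + 1 := by
    linear_combination hprod u + hplus u + hminus u
  rw [Finset.sum_congr rfl fun u _ => hterm u, Finset.sum_add_distrib, Finset.sum_sub_distrib,
    Finset.sum_sub_distrib, Finset.sum_sub_distrib, hquart, ← jacobsthalSum, ← jacobsthalSum,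
    hJ] at h
  simp only [Finset.sum_ite_eq', Finset.mem_univ, if_true, Finset.sum_const, Finset.card_univ,
    nsmul_eq_mul, mul_one] at h
  linarith

end FourthPowers

theorem exists_eq_thirty_two_mul_add_thirteen {t p : ℕ} (ht : Odd t) (hp : p = 4 * t ^ 2 + 9) :
    ∃ m, p = 32 * m + 13 := by
  obtain ⟨k, hk⟩ := ht
  obtain ⟨m, hm⟩ := Nat.even_mul_succ_self k
  exact ⟨m, by rw [hp, hk]; linear_combination 16 * hm⟩

/-- The evaluation of Jacobsthal's sum for primes of the form `4 * t ^ 2 + 9`. -/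
theorem jacobsthalSum_one_eq_neg_six {t p : ℕ} [Fact p.Prime] (ht : Odd t)
    (hp : p = 4 * t ^ 2 + 9) : jacobsthalSum (ZMod p) 1 = -6 := by
  obtain ⟨m, hpm⟩ := exists_eq_thirty_two_mul_add_thirteen ht hp
  have hq : Fintype.card (ZMod p) % 8 = 5 := by rw [ZMod.card]; omega
  have hF := ringChar_ne_two_of_card_mod_eight hq
  have h1 := card_quarticPoints_eq hq
  have h2 := card_quarticPoints_eq_jacobsthalSum hq
  rw [ZMod.card] at h2
  obtain ⟨g, hg⟩ := quadraticChar_exists_neg_one hF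
  have h3 := jacobsthalSum_one_sq_add_sq hF (quadraticChar_neg_one_of_card_mod_eight hq) hg
  rw [ZMod.card] at h3
  set S := jacobsthalSum (ZMod p) 1
  set T := jacobsthalSum (ZMod p) g
  obtain ⟨a, ha⟩ : ∃ a : ℤ, S = 16 * a - 6 :=
    ⟨fourthPowerDiffCount (1 : ZMod p) - 2 * m - 1, by omega⟩
  have hT : Even T := by
    have : Even (T ^ 2) := ⟨2 * p - 2 * (8 * a - 3) ^ 2, by rw [ha] at h3; linear_combination h3⟩
    exact (Int.even_pow' two_ne_zero).mp this
  obtain ⟨b, hb⟩ := hT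
  have h9 := sq_eq_nine_of_sq_add_sq_eq (Fact.out : p.Prime) (t := t) (a := 8 * a - 3) (b := b)
    (by exact_mod_cast hp) ⟨4 * a - 2, by ring⟩ (by rw [ha, hb] at h3; linarith)
  have h0 : a * (4 * a - 3) = 0 := by linarith
  rcases mul_eq_zero.mp h0 with h | h <;> omega

/-- For odd `t` with `p = 4t² + 9` prime, the set of all fourth powers
(including 0) forms a cyclic difference set `DS(p, (p+3)/4, (p+3)/16)` in
`ℤ/pℤ`. -/
theorem biquadratic_residues_with_zero_difference_set (t p : ℕ) (ht : Odd t)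
    (hp : p = 4 * t ^ 2 + 9) [Fact p.Prime] :
    let B : Finset (ZMod p) := Finset.univ.image (fun x : ZMod p => x ^ 4)
    B.card = (p + 3) / 4 ∧
    ∀ d : ZMod p, d ≠ 0 →
      ((B ×ˢ B).filter (fun q => q.1 ≠ q.2 ∧ q.1 - q.2 = d)).card = (p + 3) / 16 := by
  intro B
  have hS := jacobsthalSum_one_eq_neg_six ht hp
  obtain ⟨m, hpm⟩ := exists_eq_thirty_two_mul_add_thirteen ht hp
  have hq : Fintype.card (ZMod p) % 8 = 5 := by rw [ZMod.card]; omega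
  have hcard := four_mul_card_fourthPowers hq
  rw [ZMod.card] at hcard
  refine ⟨?_, fun d hd => ?_⟩
  · change (fourthPowers (ZMod p)).card = _
    omega
  have hfilter : (B ×ˢ B).filter (fun q => q.1 ≠ q.2 ∧ q.1 - q.2 = d)
      = (B ×ˢ B).filter fun q => q.1 - q.2 = d := by
    refine Finset.filter_congr fun q _ => and_iff_right_of_imp ?_
    rintro rfl
    exact sub_ne_zero.mp hd
  rw [hfilter]
  change fourthPowerDiffCount d = _
  have h1 := card_quarticPoints_eq hq
  have h2 := card_quarticPoints_eq_jacobsthalSum hq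
  rw [ZMod.card, hS] at h2
  rcases quadraticChar_dichotomy hd with h | h
  · obtain ⟨e, rfl⟩ := (quadraticChar_one_iff_isSquare hd).mp h
    have he : e ≠ 0 := by rintro rfl; simp at hd
    have := fourthPowerDiffCount_mul_sq hq 1 he
    rw [one_mul, sq] at this
    rw [this]
    omega
  · have := fourthPowerDiffCount_one_add hq h
    rw [ZMod.card] at this
    omega
end

section
/- For any odd integer t and even integer u such that p = 8t² + 49 = 64u² + 441 is prime, the set of all eighth powers {x⁸ : x ∈ F_p} (including 0) is a cyclic difference set DS(p, (p+7)/8, (p+7)/64) in Z_p. -/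
/-- The three Jacobi sums attached to characters with product one agree up to sign. -/
theorem jacobiSum_eq_apply_neg_one_mul {F R : Type*} [Field F] [Fintype F] [CommRing R]
    [Nontrivial R] (χ ψ : MulChar F R) :
    jacobiSum χ ψ = χ (-1) * jacobiSum χ (χ * ψ)⁻¹ := by
  rw [jacobiSum_comm χ ψ, jacobiSum_comm χ (χ * ψ)⁻¹]
  unfold jacobiSum
  rw [← Equiv.sum_comp (Equiv.inv F), Finset.mul_sum]
  refine Finset.sum_congr rfl fun x _ => ?_
  rcases eq_or_ne x 0 with rfl | hx
  · simp [MulChar.map_zero]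
  · have h : 1 - x⁻¹ = -1 * (1 - x) * x⁻¹ := by field_simp; ring
    rw [Equiv.inv_apply, h, map_mul, map_mul, MulChar.inv_apply', MulChar.mul_apply]
    ring

theorem apply_four_mul_jacobiSum_self {F R : Type*} [Field F] [Fintype F] [DecidableEq F]
    [CommRing R] [IsDomain R] (hF : ringChar F ≠ 2) {χ : MulChar F R} (hχ : χ ≠ 1) :
    χ 4 * jacobiSum χ χ =
      jacobiSum χ ((quadraticChar F).ringHomComp (Int.castRingHom R)) := by
  have h2 : (2 : F) ≠ 0 := Ring.two_ne_zero hF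
  have h1 : χ 4 * jacobiSum χ χ = ∑ x : F, χ (1 - x ^ 2) := by
    let e : F ≃ F := (Equiv.mulLeft₀ (2 : F) h2).trans (Equiv.subRight 1)
    rw [jacobiSum, Finset.mul_sum, ← e.sum_comp (fun x => χ (1 - x ^ 2))]
    refine Finset.sum_congr rfl fun x _ => ?_
    rw [← map_mul, ← map_mul]
    congr 1
    simp [e]
    ring
  have h3 : ∑ x : F, χ (1 - x ^ 2) =
      ∑ y : F, ((quadraticChar F y : ℤ) + 1 : R) * χ (1 - y) := by
    rw [← Finset.sum_fiberwise_of_maps_to (s := Finset.univ) (t := Finset.univ)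
      (g := fun x : F => x ^ 2) (fun _ _ => Finset.mem_univ _)]
    refine Finset.sum_congr rfl fun y _ => ?_
    have hc := quadraticChar_card_sqrts hF y
    have hs : {x : F | x ^ 2 = y}.toFinset = Finset.univ.filter fun x : F => x ^ 2 = y := by
      ext; simp
    rw [hs] at hc
    rw [Finset.sum_congr rfl (g := fun _ => χ (1 - y))
      (fun x hx => by rw [(Finset.mem_filter.1 hx).2]), Finset.sum_const, nsmul_eq_mul]
    congr 1
    exact_mod_cast congrArg (Int.cast : ℤ → R) hc
  have h4 : ∑ y : F, χ (1 - y) = 0 := by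
    rw [← MulChar.sum_eq_zero_of_ne_one hχ]
    exact (Equiv.subLeft (1 : F)).sum_comp χ
  rw [h1, h3, jacobiSum_comm]
  simp only [add_mul, one_mul, Finset.sum_add_distrib, h4, add_zero]
  rfl

/-- A form of the quadratic Hasse-Davenport relation. -/
theorem apply_four_mul_jacobiSum_mul_quadraticChar {F K : Type*} [Field F] [Fintype F]
    [DecidableEq F] [Field K] (hF : ringChar F ≠ 2) (hK : (Fintype.card F : K) ≠ 0)
    {ψ : AddChar F K} (hψ : ψ.IsPrimitive) {χ φ : MulChar F K}
    (hφ : φ = (quadraticChar F).ringHomComp (Int.castRingHom K))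
    (h1 : χ ^ 2 ≠ 1) (h2 : χ * φ ≠ 1) (h3 : χ ^ 2 * φ ≠ 1) :
    χ 4 * jacobiSum χ (χ * φ) = jacobiSum (χ ^ 2) φ := by
  have h0 : χ ≠ 1 := by rintro rfl; simp at h1
  have e1 := jacobiSum_mul_nontrivial (χ := χ) (φ := χ) (by rwa [← sq]) ψ
  have e2 := jacobiSum_mul_nontrivial h2 ψ
  have e3 := jacobiSum_mul_nontrivial (χ := χ) (φ := χ * φ) (by rwa [← mul_assoc, ← sq]) ψ
  have e4 := jacobiSum_mul_nontrivial h3 ψ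
  have e5 := apply_four_mul_jacobiSum_self hF h0
  rw [← hφ] at e5
  rw [← sq] at e1
  rw [← mul_assoc, ← sq] at e3
  have g1 := gaussSum_ne_zero_of_nontrivial hK h0 hψ
  have g2 := gaussSum_ne_zero_of_nontrivial hK h3 hψ
  apply mul_left_cancel₀ (mul_ne_zero g1 g2)
  linear_combination χ 4 * gaussSum χ ψ * e3 - gaussSum χ ψ * e4
    - χ 4 * gaussSum (χ * φ) ψ * e1 + gaussSum (χ ^ 2) ψ * gaussSum (χ * φ) ψ * e5
    + gaussSum (χ ^ 2) ψ * e2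

/-- Two representations of a prime by `x ^ 2 + k * y ^ 2` agree, up to signs and, for `k = 1`,
the order of the summands. -/
theorem Int.sq_eq_sq_of_prime_eq_sq_add_mul_sq {p x y a b k : ℤ} (hp : Prime p) (hp0 : 0 < p)
    (hk : 0 < k) (h1 : x ^ 2 + k * y ^ 2 = p) (h2 : a ^ 2 + k * b ^ 2 = p) :
    b ^ 2 = y ^ 2 ∨ k = 1 ∧ a ^ 2 = y ^ 2 := by
  have key : ∀ b : ℤ, a ^ 2 + k * b ^ 2 = p → p ∣ x * b + y * a →
      b ^ 2 = y ^ 2 ∨ k = 1 ∧ a ^ 2 = y ^ 2 := by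
    rintro b h2 ⟨c, hc⟩
    have e : p ^ 2 = (x * a - k * y * b) ^ 2 + k * (p * c) ^ 2 := by
      rw [← hc]
      linear_combination (-p) * h1 - (x ^ 2 + k * y ^ 2) * h2
    have hb : (x * b + y * a) * (x * b - y * a) = p * (b ^ 2 - y ^ 2) := by
      linear_combination b ^ 2 * h1 - y ^ 2 * h2
    rcases eq_or_ne c 0 with rfl | hc0
    · left
      rw [hc] at hb
      have : p * (b ^ 2 - y ^ 2) = 0 := by rw [← hb]; ring
      rcases mul_eq_zero.1 this with h | h <;> linarith
    · right
      have hc1 : 1 ≤ c ^ 2 := by have := sq_pos_of_ne_zero hc0; linarith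
      have hpp : 0 < p ^ 2 := by positivity
      have hkc : k * c ^ 2 ≤ 1 := by
        by_contra! h
        nlinarith [sq_nonneg (x * a - k * y * b)]
      have hk1 : k = 1 := by nlinarith
      subst hk1
      have hcc : c ^ 2 = 1 := by linarith
      have hz : (x * a - y * b) ^ 2 = 0 := by
        have := e
        rw [mul_pow, hcc] at this
        linarith
      have hz := pow_eq_zero_iff (two_ne_zero) |>.1 hz
      have : p * (a ^ 2 - y ^ 2) = 0 := by
        linear_combination (x * a + y * b) * hz - a ^ 2 * h1 + y ^ 2 * h2
      refine ⟨rfl, ?_⟩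
      rcases mul_eq_zero.1 this with h | h <;> linarith
  have hd : p ∣ (x * b + y * a) * (x * b - y * a) :=
    ⟨b ^ 2 - y ^ 2, by linear_combination b ^ 2 * h1 - y ^ 2 * h2⟩
  rcases hp.dvd_or_dvd hd with h | h
  · exact key b h2 h
  · have := key (-b) (by rw [neg_sq]; exact h2) (by
      obtain ⟨c, hc⟩ := h
      exact ⟨-c, by linear_combination -hc⟩)
    simpa using this

theorem isPrimitiveRoot_eight_of_pow_four_eq_neg_one {ζ : ℂ} (h : ζ ^ 4 = -1) :
    IsPrimitiveRoot ζ 8 := by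
  have h1 : orderOf ζ = 2 ^ (2 + 1) :=
    orderOf_eq_prime_pow (by norm_num [h]) (by
      rw [show 2 ^ (2 + 1) = 4 * 2 from rfl, pow_mul, h]; norm_num)
  rw [show 8 = orderOf ζ by rw [h1]; norm_num]
  exact IsPrimitiveRoot.orderOf ζ

/-- A character of order eight on a finite field; its kernel consists of the eighth powers and its
fourth power is the quadratic character. -/
theorem exists_mulChar_octic {F : Type*} [Field F] [Fintype F] [DecidableEq F]
    (hF : 8 ∣ Fintype.card F - 1) :
    ∃ χ : MulChar F ℂ, χ ^ 8 = 1 ∧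
      χ ^ 4 = (quadraticChar F).ringHomComp (Int.castRingHom ℂ) ∧
      (∃ g : Fˣ, χ g ^ 4 = -1) ∧ ∀ x : F, x ≠ 0 → (χ x = 1 ↔ ∃ y, y ^ 8 = x) := by
  obtain ⟨χ, hχ⟩ := MulChar.exists_mulChar_orderOf F hF
    (Complex.isPrimitiveRoot_exp 8 (by norm_num))
  obtain ⟨g, hg⟩ := IsCyclic.exists_generator (α := Fˣ)
  have h8 : χ ^ 8 = 1 := by rw [← hχ]; exact pow_orderOf_eq_one χ
  have hu : ∀ x : Fˣ, χ x ^ 8 = 1 := fun x => by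
    rw [← MulChar.pow_apply_coe, h8, MulChar.one_apply_coe]
  have hg4 : χ g ^ 4 = -1 := by
    have h1 : χ g ^ 4 ≠ 1 := by
      intro h
      have : χ ^ 4 = 1 := (MulChar.eq_iff hg _ _).2 (by
        rw [MulChar.pow_apply_coe, h, MulChar.one_apply_coe])
      have := orderOf_dvd_of_pow_eq_one this
      rw [hχ] at this
      omega
    have h2 : (χ g ^ 4 - 1) * (χ g ^ 4 + 1) = 0 := by linear_combination hu g
    rcases mul_eq_zero.1 h2 with h | h
    · exact absurd (sub_eq_zero.1 h) h1
    · exact eq_neg_of_add_eq_zero_left h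
  refine ⟨χ, h8, (MulChar.eq_iff hg _ _).2 ?_, ⟨g, hg4⟩, fun x hx => ⟨fun h => ?_, ?_⟩⟩
  · have hns : ¬ IsSquare (g : F) := by
      rintro ⟨y, hy⟩
      have hy0 : y ≠ 0 := by rintro rfl; simp at hy
      have := hu (Units.mk0 y hy0)
      have h2 : χ g = χ y ^ 2 := by rw [hy, map_mul, sq]
      rw [h2, ← pow_mul] at hg4
      rw [Units.val_mk0, hg4] at this
      norm_num at this
    rw [MulChar.pow_apply_coe, hg4, MulChar.ringHomComp_apply,
      quadraticChar_neg_one_iff_not_isSquare.2 hns]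
    simp
  · obtain ⟨n, hn⟩ := mem_powers_iff_mem_zpowers.2 (hg (Units.mk0 x hx))
    have hx' : x = (g : F) ^ n := by
      have := congrArg Units.val hn
      simpa using this.symm
    rw [hx', map_pow] at h
    obtain ⟨m, rfl⟩ := (isPrimitiveRoot_eight_of_pow_four_eq_neg_one hg4).dvd_of_pow_eq_one _ h
    exact ⟨(g : F) ^ m, by rw [hx', ← pow_mul]; congr 1; ring⟩
  · rintro ⟨y, rfl⟩
    have hy0 : y ≠ 0 := by rintro rfl; simp at hx
    rw [map_pow]
    exact hu (Units.mk0 y hy0)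

theorem mulChar_octic_neg_one {F : Type*} [Field F] [Fintype F]
    (hF : Fintype.card F % 16 = 9) {χ : MulChar F ℂ}
    (hχ : ∀ x : F, x ≠ 0 → (χ x = 1 ↔ ∃ y, y ^ 8 = x)) : χ (-1) = -1 := by
  have h2 : (χ (-1) - 1) * (χ (-1) + 1) = 0 := by
    have : χ (-1) * χ (-1) = 1 := by rw [← map_mul]; simp
    linear_combination this
  rcases mul_eq_zero.1 h2 with h | h
  · obtain ⟨y, hy⟩ := (hχ (-1) (by simp)).1 (sub_eq_zero.1 h)
    have hy0 : y ≠ 0 := by rintro rfl; simp at hy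
    have h1 := FiniteField.pow_card_sub_one_eq_one y hy0
    have h3 : Fintype.card F - 1 = 8 * (2 * (Fintype.card F / 16) + 1) := by omega
    rw [h3, pow_mul, hy, Odd.neg_one_pow ⟨_, rfl⟩] at h1
    have hodd : Fintype.card F % 2 = 1 := by omega
    refine absurd h1 (Ring.neg_one_ne_one_of_char_ne_two fun hc => ?_)
    have := FiniteField.even_card_of_char_two hc
    omega
  · exact eq_neg_of_add_eq_zero_left h

theorem exists_sum_comp_eq_sum_range {α K : Type*} [DecidableEq K] [CommRing K] [IsDomain K]
    {ζ : K} {n : ℕ} [NeZero n] (hζ : IsPrimitiveRoot ζ n) (S : Finset α) (c : α → K)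
    (hc : ∀ x ∈ S, c x ^ n = 1) :
    ∃ E : ℕ → ℕ, ∀ f : K → K, ∑ x ∈ S, f (c x) = ∑ k ∈ Finset.range n, E k * f (ζ ^ k) := by
  refine ⟨fun k => (S.filter fun x => c x = ζ ^ k).card, fun f => ?_⟩
  have hinj : Set.InjOn (fun k => ζ ^ k) (Finset.range n : Set ℕ) := fun i hi j hj h =>
    hζ.pow_inj (by simpa using hi) (by simpa using hj) h
  rw [← Finset.sum_fiberwise_of_maps_to (t := (Finset.range n).image (ζ ^ ·)) (g := c),
    Finset.sum_image hinj]
  · refine Finset.sum_congr rfl fun k _ => ?_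
    rw [Finset.sum_congr rfl (g := fun _ => f (ζ ^ k))
      (fun x hx => by rw [(Finset.mem_filter.1 hx).2]), Finset.sum_const, nsmul_eq_mul]
  · intro x hx
    obtain ⟨i, hi, h⟩ := hζ.eq_pow_of_pow_eq_one (hc x hx)
    exact Finset.mem_image.2 ⟨i, by simpa using hi, h⟩

/-- Jacobi sums with a quadratic character, expanded over the values of the other character. The
coefficients do not depend on the exponent `j`. -/
theorem exists_jacobiSum_pow_eq {F K : Type*} [Field F] [Fintype F] [CommRing K] [IsDomain K]
    {ζ : K} {n : ℕ} [NeZero n] (hζ : IsPrimitiveRoot ζ n) {χ φ : MulChar F K} (hχ : χ ^ n = 1)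
    (hφ : φ ^ 2 = 1) (hφ1 : φ ≠ 1) :
    ∃ E : ℕ → ℕ, ∀ j : ℕ, χ ^ j ≠ 1 → jacobiSum (χ ^ j) φ =
      -(Fintype.card F : K) + 2 * ∑ k ∈ Finset.range n, E k * (1 - ζ ^ (j * k)) := by
  classical
  let S : Finset F := Finset.univ.filter fun x => x ≠ 0 ∧ φ (1 - x) = -1
  have hu : ∀ x : F, x ≠ 0 → χ x ^ n = 1 := fun x hx => by
    have := MulChar.pow_apply_coe χ n (Units.mk0 x hx)
    rw [hχ, MulChar.one_apply_coe] at this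
    exact this.symm
  obtain ⟨E, hE⟩ := exists_sum_comp_eq_sum_range hζ S χ
    fun x hx => hu x (Finset.mem_filter.1 hx).2.1
  refine ⟨E, fun j hj => ?_⟩
  have hj0 : j ≠ 0 := by rintro rfl; simp at hj
  have h1 : ∑ x : F, (1 - (χ ^ j) x) * (1 - φ (1 - x)) =
      Fintype.card F + jacobiSum (χ ^ j) φ := by
    have e1 : ∑ x : F, φ (1 - x) = 0 := by
      rw [← MulChar.sum_eq_zero_of_ne_one hφ1]
      exact (Equiv.subLeft (1 : F)).sum_comp φ
    have e2 := MulChar.sum_eq_zero_of_ne_one hj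
    have e3 : ∀ x : F, (1 - (χ ^ j) x) * (1 - φ (1 - x)) =
      1 - (χ ^ j) x - φ (1 - x) + (χ ^ j) x * φ (1 - x) := fun x => by ring
    simp only [e3, Finset.sum_add_distrib, Finset.sum_sub_distrib, e1, e2, jacobiSum]
    simp
  have h2 : ∑ x : F, (1 - (χ ^ j) x) * (1 - φ (1 - x)) = ∑ x ∈ S, 2 * (1 - χ x ^ j) := by
    rw [Finset.sum_filter]
    refine Finset.sum_congr rfl fun x _ => ?_
    rw [MulChar.pow_apply' χ hj0]
    rcases eq_or_ne x 0 with rfl | hx0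
    · simp
    rcases eq_or_ne x 1 with rfl | hx1
    · simp
    have hx : 1 - x ≠ 0 := sub_ne_zero.2 hx1.symm
    have h3 := MulChar.pow_apply_coe φ 2 (Units.mk0 _ hx)
    rw [hφ, MulChar.one_apply_coe, Units.val_mk0] at h3
    have h4 : (φ (1 - x) - 1) * (φ (1 - x) + 1) = 0 := by linear_combination -h3
    split_ifs with h
    · rw [h.2]; ring
    · rcases mul_eq_zero.1 h4 with h5 | h5
      · rw [sub_eq_zero.1 h5]; ring
      · exact absurd ⟨hx0, eq_neg_of_add_eq_zero_left h5⟩ h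
  have h3 := hE fun z => 2 * (1 - z ^ j)
  rw [← h2, h1] at h3
  rw [Finset.mul_sum, ← sub_eq_iff_eq_add', sub_neg_eq_add, add_comm, h3]
  refine Finset.sum_congr rfl fun k _ => ?_
  rw [← pow_mul, mul_comm k j]
  ring

theorem ite_exists_pow_eight_eq_sum {F : Type*} [Field F] [Fintype F] [DecidableEq F]
    {χ : MulChar F ℂ} (h8 : χ ^ 8 = 1)
    (hχ : ∀ x : F, x ≠ 0 → (χ x = 1 ↔ ∃ y, y ^ 8 = x)) (x : F) :
    (if x ∈ Finset.univ.image (fun y : F => y ^ 8) then 8 else 0 : ℂ) =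
      (if x = 0 then 8 else 0) + ∑ j ∈ Finset.range 8, (χ ^ j) x := by
  simp only [Finset.mem_image, Finset.mem_univ, true_and]
  rcases eq_or_ne x 0 with rfl | hx
  · rw [if_pos ⟨0, by simp⟩]
    simp [MulChar.map_zero]
  · have hw : ∀ j, (χ ^ j) x = χ x ^ j := fun j => MulChar.pow_apply_coe χ j (Units.mk0 x hx)
    have hw8 : χ x ^ 8 = 1 := by
      rw [← hw, h8]
      exact MulChar.one_apply_coe (Units.mk0 x hx)
    simp only [hw, ← hχ x hx, hx, if_false, zero_add]
    split_ifs with h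
    · simp [h]
    · have := mul_geom_sum (χ x) 8
      rw [hw8, sub_self] at this
      exact ((mul_eq_zero.1 this).resolve_left (sub_ne_zero.2 h)).symm

theorem sum_apply_mul_apply_add {F R : Type*} [Field F] [Fintype F] [CommRing R]
    (χ ψ : MulChar F R) {d : F} (hd : d ≠ 0) :
    ∑ x, χ x * ψ (x + d) = χ (-1) * (χ d * ψ d) * jacobiSum χ ψ := by
  rw [jacobiSum, Finset.mul_sum, ← Equiv.sum_comp (Equiv.mulLeft₀ (-d) (neg_ne_zero.2 hd))]
  refine Finset.sum_congr rfl fun x _ => ?_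
  have h1 : (Equiv.mulLeft₀ (-d) (neg_ne_zero.2 hd)) x = -1 * d * x := by simp
  have h2 : -1 * d * x + d = d * (1 - x) := by ring
  rw [h1, h2, map_mul, map_mul, map_mul]
  ring

/-- The number of representations of `d` as a difference of eighth powers, in terms of the Jacobi
sums of the powers of a character of order eight. -/
theorem octic_difference_count {F : Type*} [Field F] [Fintype F] [DecidableEq F]
    {χ : MulChar F ℂ} (h8 : χ ^ 8 = 1)
    (hχ : ∀ x : F, x ≠ 0 → (χ x = 1 ↔ ∃ y, y ^ 8 = x)) (hneg : χ (-1) = -1)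
    {B : Finset F} (hB : B = Finset.univ.image (fun y : F => y ^ 8)) {d : F} (hd : d ≠ 0) :
    64 * (((B ×ˢ B).filter (fun q => q.1 ≠ q.2 ∧ q.1 - q.2 = d)).card : ℂ) =
      ∑ i ∈ Finset.range 8, ∑ j ∈ Finset.range 8,
        (-1) ^ i * χ d ^ (i + j) * jacobiSum (χ ^ i) (χ ^ j) +
      8 * ∑ j ∈ Finset.range 8, (1 + (-1) ^ j) * χ d ^ j := by
  have hcard : ((B ×ˢ B).filter (fun q => q.1 ≠ q.2 ∧ q.1 - q.2 = d)).card =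
      (Finset.univ.filter fun x => x ∈ B ∧ x + d ∈ B).card := by
    refine Finset.card_bij' (fun q _ => q.2) (fun x _ => (x + d, x)) ?_ ?_ ?_ ?_
    · rintro ⟨a, b⟩ h
      simp only [Finset.mem_filter, Finset.mem_product, Finset.mem_univ, true_and] at h ⊢
      obtain ⟨⟨ha, hb⟩, -, rfl⟩ := h
      exact ⟨hb, by simpa using ha⟩
    · intro x h
      simp only [Finset.mem_filter, Finset.mem_product, Finset.mem_univ, true_and] at h ⊢
      exact ⟨⟨h.2, h.1⟩, by simpa using hd, by ring⟩
    · rintro ⟨a, b⟩ h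
      simp only [Finset.mem_filter] at h
      simp [← h.2.2]
    · simp
  have hu : ∀ (j : ℕ) (x : F), x ≠ 0 → (χ ^ j) x = χ x ^ j := fun j x hx =>
    MulChar.pow_apply_coe χ j (Units.mk0 x hx)
  have hnegd : χ (-d) = -χ d := by rw [← neg_one_mul, map_mul, hneg, neg_one_mul]
  have h1 : 64 * ((Finset.univ.filter fun x => x ∈ B ∧ x + d ∈ B).card : ℂ) =
      ∑ x : F, (if x ∈ B then 8 else 0 : ℂ) * (if x + d ∈ B then 8 else 0 : ℂ) := by
    rw [Finset.card_filter, Nat.cast_sum, Finset.mul_sum]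
    refine Finset.sum_congr rfl fun x _ => ?_
    by_cases ha : x ∈ B <;> by_cases hb : x + d ∈ B <;> norm_num [ha, hb]
  have h2 : ∀ x : F, (if x ∈ B then 8 else 0 : ℂ) * (if x + d ∈ B then 8 else 0 : ℂ) =
      (if x = 0 then 8 * ∑ j ∈ Finset.range 8, (χ ^ j) (x + d) else 0) +
      (if x = -d then 8 * ∑ j ∈ Finset.range 8, (χ ^ j) x else 0) +
      ∑ i ∈ Finset.range 8, ∑ j ∈ Finset.range 8, (χ ^ i) x * (χ ^ j) (x + d) := fun x => by
    rw [hB, ite_exists_pow_eight_eq_sum h8 hχ, ite_exists_pow_eight_eq_sum h8 hχ,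
      ← Finset.sum_mul_sum]
    have e : x + d = 0 ↔ x = -d := eq_neg_iff_add_eq_zero.symm
    simp only [e]
    by_cases hx : x = 0
    · have hx' : ¬ x = -d := by rw [hx]; simpa [eq_comm] using hd
      simp only [hx, if_true]
      rw [if_neg (by rwa [← hx]), if_neg (by rwa [← hx])]
      ring
    · by_cases hxd : x = -d
      · rw [if_neg hx, if_pos hxd, if_neg hx, if_pos hxd]; ring
      · rw [if_neg hx, if_neg hxd, if_neg hx, if_neg hxd]; ring
  rw [hcard, h1]
  simp only [h2, Finset.sum_add_distrib, Finset.sum_ite_eq', Finset.mem_univ, if_true, zero_add]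
  rw [Finset.sum_comm, add_comm]
  congr 1
  · refine Finset.sum_congr rfl fun i _ => ?_
    rw [Finset.sum_comm]
    refine Finset.sum_congr rfl fun j _ => ?_
    rw [sum_apply_mul_apply_add _ _ hd, hu _ _ hd, hu _ _ hd, hu _ _ (by simp), hneg, pow_add]
  · rw [← mul_add, ← Finset.sum_add_distrib]
    congr 1
    refine Finset.sum_congr rfl fun j _ => ?_
    rw [hu _ _ hd, hu _ _ (neg_ne_zero.2 hd), hnegd, neg_pow]
    ring

theorem jacobiSum_pow_eq_of_dvd {F R : Type*} [Field F] [Fintype F] [CommRing R] [Nontrivial R]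
    {χ : MulChar F R} {n : ℕ} (hn : χ ^ n = 1) (hneg : χ (-1) = -1) {i j k : ℕ}
    (h : n ∣ i + j + k) :
    jacobiSum (χ ^ i) (χ ^ j) = (-1) ^ i * jacobiSum (χ ^ i) (χ ^ k) := by
  obtain ⟨c, hc⟩ := h
  have h1 : (χ ^ i * χ ^ j)⁻¹ = χ ^ k := inv_eq_of_mul_eq_one_right (by
    rw [← pow_add, ← pow_add, hc, pow_mul, hn, one_pow])
  have h2 : (χ ^ i) (-1) = (-1) ^ i := by
    rw [← hneg]
    exact MulChar.pow_apply_coe χ i (-1)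
  rw [jacobiSum_eq_apply_neg_one_mul, h1, h2]

theorem mulChar_octic_pow_ne_one {F : Type*} [Field F] {χ : MulChar F ℂ} {g : Fˣ}
    (hg : χ g ^ 4 = -1) {j : ℕ} (hj : ¬ 8 ∣ j) : χ ^ j ≠ 1 := by
  intro h
  have h2 : χ g ^ j = 1 := by rw [← MulChar.pow_apply_coe, h, MulChar.one_apply_coe]
  exact hj ((isPrimitiveRoot_eight_of_pow_four_eq_neg_one hg).dvd_of_pow_eq_one _ h2)

theorem octic_jacobiSum_sum_eq {F : Type*} [Field F] [Fintype F] [DecidableEq F]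
    (hF : ringChar F ≠ 2) {χ : MulChar F ℂ} (h8 : χ ^ 8 = 1)
    (hφ : χ ^ 4 = (quadraticChar F).ringHomComp (Int.castRingHom ℂ))
    {g : Fˣ} (hg : χ g ^ 4 = -1) (hneg : χ (-1) = -1) (hε : χ 4 ^ 2 = 1)
    {ψ : AddChar F ℂ} (hψ : ψ.IsPrimitive) {w : ℂ} (hw : w ^ 8 = 1) :
    ∑ i ∈ Finset.range 8, ∑ j ∈ Finset.range 8,
        (-1) ^ i * w ^ (i + j) * jacobiSum (χ ^ i) (χ ^ j) +
      8 * ∑ j ∈ Finset.range 8, (1 + (-1) ^ j) * w ^ j =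
    Fintype.card F + 7 +
      (14 + χ 4 * (jacobiSum (χ ^ 1) (χ ^ 3) + jacobiSum (χ ^ 5) (χ ^ 7))) * (w ^ 2 + w ^ 6) +
      2 * (1 - χ 4) * (jacobiSum (χ ^ 6) (χ ^ 4) * w ^ 2 + jacobiSum (χ ^ 2) (χ ^ 4) * w ^ 6) +
      (14 - 2 * (jacobiSum (χ ^ 1) (χ ^ 3) + jacobiSum (χ ^ 5) (χ ^ 7)) +
        (jacobiSum (χ ^ 2) (χ ^ 4) + jacobiSum (χ ^ 6) (χ ^ 4))) * w ^ 4 := by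
  have hne : ∀ j, ¬ 8 ∣ j → χ ^ j ≠ 1 := fun j hj => mulChar_octic_pow_ne_one hg hj
  have hcyc : ∀ i j k, 8 ∣ i + j + k →
      jacobiSum (χ ^ i) (χ ^ j) = (-1) ^ i * jacobiSum (χ ^ i) (χ ^ k) :=
    fun i j k h => jacobiSum_pow_eq_of_dvd h8 hneg h
  have hself : ∀ i, ¬ 8 ∣ i →
      χ 4 ^ i * jacobiSum (χ ^ i) (χ ^ i) = jacobiSum (χ ^ i) (χ ^ 4) := fun i hi => by
    have := apply_four_mul_jacobiSum_self hF (hne i hi)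
    rwa [← hφ, MulChar.pow_apply' χ (by rintro rfl; simp at hi)] at this
  have hq : (Fintype.card F : ℂ) ≠ 0 := by simp
  have hmul : ∀ i, ¬ 8 ∣ i * 2 → ¬ 8 ∣ i + 4 → ¬ 8 ∣ i * 2 + 4 →
      χ 4 ^ i * jacobiSum (χ ^ i) (χ ^ (i + 4)) = jacobiSum (χ ^ (i * 2)) (χ ^ 4) :=
    fun i h1 h2 h3 => by
    have := apply_four_mul_jacobiSum_mul_quadraticChar hF hq hψ (χ := χ ^ i) hφ
      (by rw [← pow_mul]; exact hne _ h1) (by rw [← pow_add]; exact hne _ h2)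
      (by rw [← pow_mul, ← pow_add]; exact hne _ h3)
    rwa [← pow_mul, ← pow_add, MulChar.pow_apply' χ (by rintro rfl; simp at h1)] at this
  have hinv : ∀ i j, ¬ 8 ∣ i → i + j = 8 →
      jacobiSum (χ ^ i) (χ ^ j) = -(-1) ^ i := fun i j hi hij => by
    have h1 : χ ^ j = (χ ^ i)⁻¹ := eq_inv_of_mul_eq_one_right (by rw [← pow_add, hij, h8])
    rw [h1, jacobiSum_nontrivial_inv (hne i hi)]
    congr 1
    rw [← hneg]
    exact MulChar.pow_apply_coe χ i (-1)
  have hone : ∀ j, ¬ 8 ∣ j → jacobiSum (χ ^ 0) (χ ^ j) = -1 := fun j hj => by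
    rw [pow_zero, jacobiSum_one_nontrivial (hne j hj)]
  have h00 : jacobiSum (χ ^ 0) (χ ^ 0) = (Fintype.card F : ℂ) - 2 := by
    rw [pow_zero, jacobiSum_one_one]
  have hsymm : ∀ i j, jacobiSum (χ ^ i) (χ ^ j) = jacobiSum (χ ^ j) (χ ^ i) :=
    fun i j => jacobiSum_comm _ _
  generalize χ 4 = ε at *
  obtain ⟨J, hJ⟩ : ∃ J : ℕ → ℕ → ℂ, ∀ i j, jacobiSum (χ ^ i) (χ ^ j) = J i j := ⟨_, fun _ _ => rfl⟩
  simp only [hJ] at *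
  have c14 := hcyc 1 3 4 (by norm_num)
  have c54 := hcyc 5 7 4 (by norm_num)
  have c34 := hcyc 3 1 4 (by norm_num)
  have c74 := hcyc 7 5 4 (by norm_num)
  have c22 := hcyc 2 2 4 (by norm_num)
  have c66 := hcyc 6 6 4 (by norm_num)
  have s1 := hself 1 (by norm_num)
  have s3 := hself 3 (by norm_num)
  have s5 := hself 5 (by norm_num)
  have s7 := hself 7 (by norm_num)
  have m1 := hmul 1 (by norm_num) (by norm_num) (by norm_num)
  have m3 := hmul 3 (by norm_num) (by norm_num) (by norm_num)
  norm_num at c14 c54 c34 c74 c22 c66 m1 m3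
  have ε3 : ε ^ 3 = ε := by linear_combination ε * hε
  have ε5 : ε ^ 5 = ε := by linear_combination (ε ^ 3 + ε) * hε
  have ε7 : ε ^ 7 = ε := by linear_combination (ε ^ 5 + ε ^ 3 + ε) * hε
  rw [pow_one] at s1
  rw [ε3] at s3 m3
  rw [ε5] at s5
  rw [ε7] at s7
  have cancel : ∀ {a b : ℂ}, ε * a = b → a = ε * b := fun {a b} h => by
    linear_combination ε * h - a * hε
  have v11 : J 1 1 = -(ε * J 1 3) := by rw [cancel s1, c14]; ring
  have v33 : J 3 3 = -(ε * J 1 3) := by rw [cancel s3, hsymm 1 3, c34]; ring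
  have v55 : J 5 5 = -(ε * J 5 7) := by rw [cancel s5, c54]; ring
  have v77 : J 7 7 = -(ε * J 5 7) := by rw [cancel s7, hsymm 5 7, c74]; ring
  have v15 := cancel m1
  have v37 := cancel m3
  have w9 : w ^ 9 = w := by linear_combination w * hw
  have w10 : w ^ 10 = w ^ 2 := by linear_combination w ^ 2 * hw
  have w11 : w ^ 11 = w ^ 3 := by linear_combination w ^ 3 * hw
  have w12 : w ^ 12 = w ^ 4 := by linear_combination w ^ 4 * hw
  have w13 : w ^ 13 = w ^ 5 := by linear_combination w ^ 5 * hw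
  have w14 : w ^ 14 = w ^ 6 := by linear_combination w ^ 6 * hw
  simp only [Finset.sum_range_succ, Finset.sum_range_zero, Nat.reduceAdd, zero_add, add_zero,
    hw, w9, w10, w11, w12, w13, w14, h00,
    hsymm 1 0, hsymm 2 0, hsymm 3 0, hsymm 4 0, hsymm 5 0, hsymm 6 0, hsymm 7 0,
    hone 1 (by norm_num), hone 2 (by norm_num), hone 3 (by norm_num), hone 4 (by norm_num),
    hone 5 (by norm_num), hone 6 (by norm_num), hone 7 (by norm_num),
    hinv 1 7 (by norm_num) rfl, hinv 2 6 (by norm_num) rfl, hinv 3 5 (by norm_num) rfl,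
    hinv 4 4 (by norm_num) rfl, hinv 5 3 (by norm_num) rfl, hinv 6 2 (by norm_num) rfl,
    hinv 7 1 (by norm_num) rfl,
    hsymm 2 1, hsymm 3 1, hsymm 3 2, hsymm 4 1, hsymm 4 2, hsymm 4 3, hsymm 5 1, hsymm 5 2,
    hsymm 5 4, hsymm 6 1, hsymm 6 3, hsymm 4 6, hsymm 6 5, hsymm 7 2, hsymm 7 3, hsymm 7 4,
    hsymm 7 5, hsymm 7 6, v11, v33, v55, v77, v15, v37, c22, c66]
  ring

theorem octic_jacobiSum_add_eq {F : Type*} [Field F] [Fintype F]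
    {χ : MulChar F ℂ} (h8 : χ ^ 8 = 1)
    {g : Fˣ} (hg : χ g ^ 4 = -1) (hneg : χ (-1) = -1)
    {t u : ℤ} (hq : Prime (Fintype.card F : ℤ))
    (h1 : (Fintype.card F : ℤ) = 8 * t ^ 2 + 49) (h2 : (Fintype.card F : ℤ) = 64 * u ^ 2 + 441) :
    jacobiSum (χ ^ 1) (χ ^ 3) + jacobiSum (χ ^ 5) (χ ^ 7) = -14 ∧
      jacobiSum (χ ^ 2) (χ ^ 4) + jacobiSum (χ ^ 6) (χ ^ 4) = -42 := by
  have hne : ∀ j, ¬ 8 ∣ j → χ ^ j ≠ 1 := fun j hj => mulChar_octic_pow_ne_one hg hj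
  set ζ := χ g
  have hprim : IsPrimitiveRoot ζ 8 := isPrimitiveRoot_eight_of_pow_four_eq_neg_one hg
  obtain ⟨E, hE⟩ := exists_jacobiSum_pow_eq hprim h8 (φ := χ ^ 4)
    (by rw [← pow_mul]; exact h8) (hne 4 (by norm_num))
  have hchar : ringChar ℂ ≠ ringChar F := by
    rw [ringChar.eq_zero]
    exact (CharP.ringChar_ne_zero_of_finite F).symm
  have hnorm : ∀ i j, ¬ 8 ∣ i → ¬ 8 ∣ j → ¬ 8 ∣ i + j → i ≤ 8 → j ≤ 8 →
      jacobiSum (χ ^ i) (χ ^ j) * jacobiSum (χ ^ (8 - i)) (χ ^ (8 - j)) = (Fintype.card F : ℂ) :=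
    fun i j hi hj hij hi8 hj8 => by
    have hinv : ∀ k, k ≤ 8 → χ ^ (8 - k) = (χ ^ k)⁻¹ := fun k hk =>
      eq_inv_of_mul_eq_one_right (by rw [← pow_add, Nat.add_sub_cancel' hk, h8])
    rw [hinv i hi8, hinv j hj8]
    exact jacobiSum_mul_jacobiSum_inv hchar (hne i hi) (hne j hj)
      (by rw [← pow_add]; exact hne _ hij)
  have n13 := hnorm 1 3 (by norm_num) (by norm_num) (by norm_num) (by norm_num) (by norm_num)
  have n24 := hnorm 2 4 (by norm_num) (by norm_num) (by norm_num) (by norm_num) (by norm_num)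
  simp only [Nat.reduceSub] at n13 n24
  have hcyc : ∀ i j k, 8 ∣ i + j + k →
      jacobiSum (χ ^ i) (χ ^ j) = (-1) ^ i * jacobiSum (χ ^ i) (χ ^ k) :=
    fun i j k h => jacobiSum_pow_eq_of_dvd h8 hneg h
  have c14 := hcyc 1 3 4 (by norm_num)
  have c54 := hcyc 5 7 4 (by norm_num)
  have c34 := hcyc 3 1 4 (by norm_num)
  have c74 := hcyc 7 5 4 (by norm_num)
  have hsymm : ∀ i j, jacobiSum (χ ^ i) (χ ^ j) = jacobiSum (χ ^ j) (χ ^ i) :=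
    fun i j => jacobiSum_comm _ _
  rw [hsymm 3 1] at c34
  rw [hsymm 7 5] at n13 c74
  obtain ⟨m0, hm0⟩ : ∃ m : ℤ, m = -(Fintype.card F : ℤ) +
    2 * (E 1 + E 2 + E 3 + E 5 + E 6 + E 7) + 4 * E 4 := ⟨_, rfl⟩
  obtain ⟨m1, hm1⟩ : ∃ m : ℤ, m = (E 5 : ℤ) - E 1 := ⟨_, rfl⟩
  obtain ⟨m2, hm2⟩ : ∃ m : ℤ, m = (E 6 : ℤ) - E 2 := ⟨_, rfl⟩
  obtain ⟨m3, hm3⟩ : ∃ m : ℤ, m = (E 7 : ℤ) - E 3 := ⟨_, rfl⟩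
  obtain ⟨X, hX⟩ : ∃ m : ℤ, m = -(Fintype.card F : ℤ) +
    2 * (E 1 + E 3 + E 5 + E 7) + 4 * (E 2 + E 6) := ⟨_, rfl⟩
  obtain ⟨Y, hY⟩ : ∃ m : ℤ, m = m3 + E 3 * 2 - m1 - E 1 * 2 := ⟨_, rfl⟩
  have hodd : ∀ j, ¬ 8 ∣ j → ∀ η : ℂ, ζ ^ j = η → η ^ 4 = -1 →
      jacobiSum (χ ^ j) (χ ^ 4) = m0 + 2 * (m1 * η + m2 * η ^ 2 + m3 * η ^ 3) := by
    rintro j hj η rfl hη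
    rw [hE j (hne j hj), hm0, hm1, hm2, hm3]
    simp only [Finset.sum_range_succ, Finset.sum_range_zero, pow_mul]
    push_cast
    linear_combination (-2) * (E 4 + E 5 * ζ ^ j + E 6 * (ζ ^ j) ^ 2 + E 7 * (ζ ^ j) ^ 3) * hη
  have heven : ∀ j, ¬ 8 ∣ j → ∀ η : ℂ, ζ ^ j = η → η ^ 2 = -1 →
      jacobiSum (χ ^ j) (χ ^ 4) = X + 2 * Y * η := by
    rintro j hj η rfl hη
    rw [hE j (hne j hj), hX, hY, hm1, hm3]
    simp only [Finset.sum_range_succ, Finset.sum_range_zero, pow_mul]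
    push_cast
    generalize ζ ^ j = η at hη ⊢
    linear_combination (-2) * (E 2 + E 3 * η + E 4 * (η ^ 2 - 1) + E 5 * (η ^ 3 - η) +
      E 6 * (η ^ 4 - η ^ 2 + 1) + E 7 * (η ^ 5 - η ^ 3 + η)) * hη
  have j1 := hodd 1 (by norm_num) ζ (pow_one _) hg
  have j3 := hodd 3 (by norm_num) (ζ ^ 3) rfl
    (by linear_combination (ζ ^ 8 - ζ ^ 4 + 1) * hg)
  have j5 := hodd 5 (by norm_num) (-ζ) (by linear_combination ζ * hg)
    (by linear_combination hg)
  have j7 := hodd 7 (by norm_num) (-ζ ^ 3) (by linear_combination ζ ^ 3 * hg)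
    (by linear_combination (ζ ^ 8 - ζ ^ 4 + 1) * hg)
  have j2 := heven 2 (by norm_num) (ζ ^ 2) rfl (by linear_combination hg)
  have j6 := heven 6 (by norm_num) (-ζ ^ 2) (by linear_combination ζ ^ 2 * hg)
    (by linear_combination hg)
  have hm2z : m2 = 0 := by
    have h : 2 * (m2 : ℂ) * ζ ^ 2 = (m1 - m3) * (ζ ^ 3 - ζ) := by
      linear_combination (c14 - c34 - j1 + j3) / 2 +
        (m2 * ζ ^ 2 + m3 * (ζ ^ 5 - ζ)) * hg
    have h' : ((4 * m2 ^ 2 + 2 * (m1 - m3) ^ 2 : ℤ) : ℂ) = 0 := by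
      push_cast
      linear_combination (-2 * (m2 : ℂ) * ζ ^ 2 - (m1 - m3) * (ζ ^ 3 - ζ)) * h +
        (4 * m2 ^ 2 - (m1 - m3) ^ 2 * (ζ ^ 2 - 2)) * hg
    have h'' : 4 * m2 ^ 2 + 2 * (m1 - m3) ^ 2 = 0 := by exact_mod_cast h'
    nlinarith [sq_nonneg m2, sq_nonneg (m1 - m3)]
  rw [hm2z, Int.cast_zero] at j1 j3 j5 j7
  have j13 : jacobiSum (χ ^ 1) (χ ^ 3) = -(m0 + (m1 + m3) * (ζ + ζ ^ 3)) := by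
    linear_combination (c14 + c34 - j1 - j3) / 2 - m3 * (ζ ^ 5 - ζ) * hg
  have j57 : jacobiSum (χ ^ 5) (χ ^ 7) = -(m0 - (m1 + m3) * (ζ + ζ ^ 3)) := by
    linear_combination (c54 + c74 - j5 - j7) / 2 + m3 * (ζ ^ 5 - ζ) * hg
  have hP : (m0 : ℤ) ^ 2 + 2 * (m1 + m3) ^ 2 = Fintype.card F := by
    have : ((m0 ^ 2 + 2 * (m1 + m3) ^ 2 : ℤ) : ℂ) = (Fintype.card F : ℤ) := by
      push_cast
      rw [j13, j57] at n13
      linear_combination n13 + (m1 + m3) ^ 2 * (ζ ^ 2 + 2) * hg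
    exact_mod_cast this
  have hA : X ^ 2 + 1 * (2 * Y) ^ 2 = Fintype.card F := by
    have : ((X ^ 2 + 1 * (2 * Y) ^ 2 : ℤ) : ℂ) = (Fintype.card F : ℤ) := by
      push_cast
      rw [j2, j6] at n24
      linear_combination n24 + 4 * Y ^ 2 * hg
    exact_mod_cast this
  have hq0 : (0 : ℤ) < Fintype.card F := by exact_mod_cast Fintype.card_pos
  have hm0' : m0 = 7 := by
    rcases Int.sq_eq_sq_of_prime_eq_sq_add_mul_sq (a := 7) (b := 2 * t) hq hq0 (by norm_num) hP
      (by rw [h1]; ring) with h | ⟨h, -⟩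
    · have hev : Even (m1 + m3) := by
        rcases sq_eq_sq_iff_eq_or_eq_neg.1 h with h | h
        · exact ⟨t, by linarith⟩
        · exact ⟨-t, by linarith⟩
      obtain ⟨c, hc⟩ := hev
      have h7 : m0 ^ 2 = 7 ^ 2 := by linarith
      rcases sq_eq_sq_iff_eq_or_eq_neg.1 h7 with h | h
      · exact h
      · exfalso
        generalize t ^ 2 = T at *
        generalize u ^ 2 = U at *
        omega
    · norm_num at h
  have hX' : X = -21 := by
    rcases Int.sq_eq_sq_of_prime_eq_sq_add_mul_sq (a := 21) (b := 8 * u) hq hq0 (by norm_num) hA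
      (by rw [h2]; ring) with h | ⟨-, h⟩
    · have hev : Even Y := by
        rcases sq_eq_sq_iff_eq_or_eq_neg.1 h with h | h
        · exact ⟨2 * u, by linarith⟩
        · exact ⟨-2 * u, by linarith⟩
      obtain ⟨c, hc⟩ := hev
      have h21 : X ^ 2 = 21 ^ 2 := by linarith
      rcases sq_eq_sq_iff_eq_or_eq_neg.1 h21 with h | h
      · exfalso
        generalize t ^ 2 = T at *
        generalize u ^ 2 = U at *
        omega
      · exact h
    · rw [mul_pow] at h
      omega
  constructor
  · rw [j13, j57, hm0']
    push_cast
    ring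
  · rw [j2, j6, hX']
    push_cast
    ring

theorem image_pow_eight_card {F : Type*} [Field F] [Fintype F] [DecidableEq F]
    {χ : MulChar F ℂ} (h8 : χ ^ 8 = 1) {g : Fˣ} (hg : χ g ^ 4 = -1)
    (hχ : ∀ x : F, x ≠ 0 → (χ x = 1 ↔ ∃ y, y ^ 8 = x)) :
    8 * (Finset.univ.image (fun y : F => y ^ 8)).card = Fintype.card F + 7 := by
  set B := Finset.univ.image (fun y : F => y ^ 8) with hB
  have h1 : 8 * (B.card : ℂ) = ∑ x : F, (if x ∈ B then 8 else 0 : ℂ) := by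
    rw [← Finset.sum_filter, Finset.sum_const, nsmul_eq_mul, Finset.filter_univ_mem, mul_comm]
  have h2 : ∀ j ∈ Finset.range 7, ∑ x : F, (χ ^ (j + 1)) x = 0 := fun j hj =>
    MulChar.sum_eq_zero_of_ne_one (mulChar_octic_pow_ne_one hg (by
      have := Finset.mem_range.1 hj
      omega))
  have h3 : ∑ x : F, (χ ^ 0) x = (Fintype.card F : ℂ) - 1 := by
    rw [pow_zero, MulChar.sum_one_eq_card_units, Fintype.card_units,
      Nat.cast_sub Fintype.card_pos, Nat.cast_one]
  have h4 : 8 * (B.card : ℂ) = Fintype.card F + 7 := by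
    rw [h1]
    simp only [hB, ite_exists_pow_eight_eq_sum h8 hχ, Finset.sum_add_distrib, Finset.sum_ite_eq',
      Finset.mem_univ, if_true]
    rw [Finset.sum_comm, Finset.sum_range_succ', h3, Finset.sum_eq_zero h2]
    ring
  exact_mod_cast h4

/-- For odd `t` and even `u` with `p = 8t² + 49 = 64u² + 441` prime, the set of
all eighth powers (including 0) forms a cyclic difference set
`DS(p, (p+7)/8, (p+7)/64)` in `ℤ/pℤ`. -/
theorem octic_residues_with_zero_difference_set (t u : ℤ) (p : ℕ) (ht : Odd t)
    (hu : Even u) (hp1 : (p : ℤ) = 8 * t ^ 2 + 49)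
    (hp2 : (p : ℤ) = 64 * u ^ 2 + 441) [Fact p.Prime] :
    let B : Finset (ZMod p) := Finset.univ.image (fun x : ZMod p => x ^ 8)
    B.card = (p + 7) / 8 ∧
    ∀ d : ZMod p, d ≠ 0 →
      ((B ×ˢ B).filter (fun q => q.1 ≠ q.2 ∧ q.1 - q.2 = d)).card = (p + 7) / 64 := by
  intro B
  have hp := Fact.out (p := p.Prime)
  have hcard : Fintype.card (ZMod p) = p := ZMod.card p
  have h64 : p % 64 = 57 := by
    generalize u ^ 2 = U at hp2
    omega
  have h16 : Fintype.card (ZMod p) % 16 = 9 := by omega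
  have hchar : ringChar (ZMod p) ≠ 2 := by
    rw [ZMod.ringChar_zmod_n]
    omega
  obtain ⟨χ, h8, hφ, ⟨g, hg⟩, hχ⟩ := exists_mulChar_octic (F := ZMod p) (by omega)
  have hneg := mulChar_octic_neg_one h16 hχ
  have h2ne : (2 : ZMod p) ≠ 0 := Ring.two_ne_zero hchar
  have hε : χ 4 ^ 2 = 1 := by
    obtain ⟨y, hy⟩ := (ZMod.exists_sq_eq_two_iff (p := p) (by omega)).2 (by omega)
    have hy0 : y ≠ 0 := by rintro rfl; exact h2ne (by simpa using hy)
    have h4 : (4 : ZMod p) = y ^ 4 := by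
      linear_combination (y * y + 2) * hy
    have h := MulChar.pow_apply_coe χ 8 (Units.mk0 y hy0)
    rw [h8, MulChar.one_apply_coe, Units.val_mk0] at h
    rw [h4, map_pow, ← pow_mul, ← h]
  obtain ⟨hP, hA⟩ := octic_jacobiSum_add_eq h8 hg hneg
    (by rw [hcard]; exact Nat.prime_iff_prime_int.1 hp) (by rw [hcard]; exact hp1)
    (by rw [hcard]; exact hp2)
  have hcount : ∀ d : ZMod p, d ≠ 0 →
      64 * (((B ×ˢ B).filter (fun q => q.1 ≠ q.2 ∧ q.1 - q.2 = d)).card : ℂ) =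
      p + 7 + 14 * (1 - χ 4) * (χ d ^ 2 + χ d ^ 6) +
      2 * (1 - χ 4) * (jacobiSum (χ ^ 6) (χ ^ 4) * χ d ^ 2 +
        jacobiSum (χ ^ 2) (χ ^ 4) * χ d ^ 6) := fun d hd => by
    have hw : χ d ^ 8 = 1 := by
      have := MulChar.pow_apply_coe χ 8 (Units.mk0 d hd)
      rw [h8, MulChar.one_apply_coe] at this
      exact this.symm
    rw [octic_difference_count h8 hχ hneg rfl hd,
      octic_jacobiSum_sum_eq hchar h8 hφ hg hneg hε (ZMod.isPrimitive_stdAddChar p) hw, hP, hA,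
      hcard]
    ring
  have hε1 : χ 4 = 1 := by
    have h : (χ 4 - 1) * (χ 4 + 1) = 0 := by linear_combination hε
    rcases mul_eq_zero.1 h with h | h
    · exact sub_eq_zero.1 h
    · exfalso
      have hε' := eq_neg_of_add_eq_zero_left h
      have c1 := hcount 1 one_ne_zero
      have c2 := hcount ((g : ZMod p) ^ 2) (pow_ne_zero 2 g.ne_zero)
      have e1 : (χ (g : ZMod p) ^ 2) ^ 2 = -1 := by rw [← pow_mul]; exact hg
      have e2 : (χ (g : ZMod p) ^ 2) ^ 6 = -1 := by
        rw [show 6 = 2 * 3 from rfl, pow_mul _ 2 3, e1]; norm_num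
      rw [map_one, hε'] at c1
      rw [map_pow, hε', e1, e2] at c2
      generalize ((B ×ˢ B).filter
        (fun q => q.1 ≠ q.2 ∧ q.1 - q.2 = (1 : ZMod p))).card = a at c1
      generalize ((B ×ˢ B).filter
        (fun q => q.1 ≠ q.2 ∧ q.1 - q.2 = (g : ZMod p) ^ 2)).card = b at c2
      have : ((64 * (a : ℤ) - 64 * b : ℤ) : ℂ) = (-224 : ℤ) := by
        push_cast
        linear_combination c1 - c2 + 8 * hA
      have : (64 * (a : ℤ) - 64 * b : ℤ) = -224 := by exact_mod_cast this
      omega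
  refine ⟨?_, fun d hd => ?_⟩
  · have := image_pow_eight_card h8 hg hχ
    rw [hcard] at this
    change 8 * B.card = p + 7 at this
    omega
  · have h := hcount d hd
    rw [hε1] at h
    have h' : 64 * (((B ×ˢ B).filter (fun q => q.1 ≠ q.2 ∧ q.1 - q.2 = d)).card : ℂ) =
        p + 7 := by linear_combination h
    have h'' : 64 * ((B ×ˢ B).filter (fun q => q.1 ≠ q.2 ∧ q.1 - q.2 = d)).card = p + 7 := by
      exact_mod_cast h'
    omega
end
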